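/- Let t, d, m, γ be positive integers. Let G ∈ C_t be a graph with no clique cutset, let (T,χ) be a tree decomposition of G and let t0 be a node of T. Suppose that for each neighbor t1 of t0 in T there is an induced subgraph Conn(t1) of G_{t0→t1} such that χ(t0) ∩ χ(t1) ⊆ Conn(t1), the set Conn(t1) ∖ χ(t0) is connected with N(Conn(t1) ∖ χ(t0)) = χ(t0) ∩ χ(t1), and no vertex of Conn(t1) ∖ χ(t0) is a hub of the graph induced on (V(G) ∖ V(G_{t0→t1})) ∪ V(Conn(t1)). Suppose γ is such that every graph in C_t with no hubs has treewidth at most γ. Let S' ⊆ Hub(G) be a stable set, let S be the set of vertices of S' that are t0-cooperative (i.e., either not in χ(t0), or of degree less than 2m(m−1) in the torso at t0), let S_bad = S' ∖ S, and let β be the induced subgraph of G on (χ(t0) ∪ ⋃_{t1 ∈ N_T(t0)} Conn(t1)) ∖ S_bad. Assume that β has no balanced separator of size at most 2m(m−1) + γ + 1 (i.e., no set X of this size such that every component of β ∖ X has at most |β|/2 vertices). Then for every s ∈ S ∩ χ(t0): (1) s has fewer than 2m(m−1) neighbors in the torso at t0; (2) s has fewer than 2m(m−1) neighbors in χ(t0);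 and (3) s is unbalanced in β, i.e., there is a component D of β ∖ N_β[s] with |D| > |β|/2. -/

import Mathlib

open Set

/-- `f` enumerates an induced path on `n` vertices in `G`. -/
def IsPathEmb {α : Type} (G : SimpleGraph α) (n : ℕ) (f : Fin n → α) : Prop :=
  Function.Injective f ∧
    ∀ i j : Fin n, G.Adj (f i) (f j) ↔ (i.val = j.val + 1 ∨ j.val = i.val + 1)

/-- `f` enumerates an induced path from `a` to `b`. -/
def IsPathFromTo {α : Type} (G : SimpleGraph α) (n : ℕ) (f : Fin n → α) (a b : α) : Prop :=
  IsPathEmb G n f ∧ ∃ h : 1 ≤ n, f ⟨0, h⟩ = a ∧ f ⟨n - 1, by omega⟩ = b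

/-- The interior (internal vertices) of the path enumerated by `f`. -/
def pathInterior {α : Type} (n : ℕ) (f : Fin n → α) : Set α :=
  {v | ∃ j : Fin n, 0 < j.val ∧ j.val < n - 1 ∧ f j = v}

/-- `k` pairwise internally vertex-disjoint induced paths from `a` to `b` in `G`. -/
def KDisjointPaths {α : Type} (G : SimpleGraph α) (k : ℕ) (a b : α) : Prop :=
  ∃ (n : Fin k → ℕ) (f : ∀ i, Fin (n i) → α),
    (∀ i, IsPathFromTo G (n i) (f i) a b) ∧
    (∀ i j, i ≠ j → Disjoint (pathInterior (n i) (f i)) (pathInterior (n j) (f j)))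

/-- `f` enumerates an induced cycle on `n` vertices. -/
def IsHoleEmb {α : Type} (G : SimpleGraph α) (n : ℕ) (f : ZMod n → α) : Prop :=
  Function.Injective f ∧ ∀ i j : ZMod n, G.Adj (f i) (f j) ↔ (i = j + 1 ∨ j = i + 1)

/-- `H` is the vertex set of a hole of `G` (an induced cycle with at least 4 vertices). -/
def IsHole {α : Type} (G : SimpleGraph α) (H : Set α) : Prop :=
  ∃ (n : ℕ) (f : ZMod n → α), 4 ≤ n ∧ IsHoleEmb G n f ∧ Set.range f = H

/-- `G` has no even hole. -/
def EvenHoleFree {α : Type} (G : SimpleGraph α) : Prop :=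
  ∀ H : Set α, IsHole G H → ¬ Even H.ncard

def Anticomplete {α : Type} (G : SimpleGraph α) (A B : Set α) : Prop :=
  ∀ a ∈ A, ∀ b ∈ B, ¬ G.Adj a b

/-- `X` is a stable (independent) set of `G`. -/
def StableSet {α : Type} (G : SimpleGraph α) (X : Set α) : Prop :=
  ∀ a ∈ X, ∀ b ∈ X, a ≠ b → ¬ G.Adj a b

/-- The open neighborhood of the set `A`. -/
def setNbhd {α : Type} (G : SimpleGraph α) (A : Set α) : Set α :=
  {v | v ∉ A ∧ ∃ a ∈ A, G.Adj v a}

/-- The set `A` induces a connected (nonempty) subgraph of `G`. -/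
def ConnSet {α : Type} (G : SimpleGraph α) (A : Set α) : Prop :=
  (G.induce A).Connected

/-- `D` is a connected component of the subgraph of `G` induced by `S`. -/
def IsCompOf {α : Type} (G : SimpleGraph α) (S D : Set α) : Prop :=
  D ⊆ S ∧ ConnSet G D ∧ ∀ D', D ⊆ D' → D' ⊆ S → ConnSet G D' → D' = D

/-- `G` contains an (induced) theta. -/
def HasTheta {α : Type} (G : SimpleGraph α) : Prop :=
  ∃ (a b : α) (n : Fin 3 → ℕ) (f : ∀ i, Fin (n i) → α),
    a ≠ b ∧ ¬ G.Adj a b ∧ (∀ i, 3 ≤ n i) ∧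
    (∀ i, IsPathFromTo G (n i) (f i) a b) ∧
    (∀ i j : Fin 3, i ≠ j → ∀ (u : Fin (n i)) (v : Fin (n j)),
      0 < u.val → u.val < n i - 1 → 0 < v.val → v.val < n j - 1 →
      f i u ≠ f j v ∧ ¬ G.Adj (f i u) (f j v))

/-- `G` contains an (induced) prism. -/
def HasPrism {α : Type} (G : SimpleGraph α) : Prop :=
  ∃ (n : Fin 3 → ℕ) (f : ∀ i, Fin (n i) → α),
    (∀ i, 2 ≤ n i) ∧ (∀ i, IsPathEmb G (n i) (f i)) ∧
    (∀ i j : Fin 3, i ≠ j → ∀ u v, f i u ≠ f j v) ∧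
    (∀ i j : Fin 3, i ≠ j → ∀ (u : Fin (n i)) (v : Fin (n j)),
      G.Adj (f i u) (f j v) ↔
        ((u.val = 0 ∧ v.val = 0) ∨ (u.val = n i - 1 ∧ v.val = n j - 1)))

/-- The neighbors of `x` in the hole `H`. -/
def holeNbrs {α : Type} (G : SimpleGraph α) (H : Set α) (x : α) : Set α :=
  {v ∈ H | G.Adj x v}

def IsWheel {α : Type} (G : SimpleGraph α) (H : Set α) (x : α) : Prop :=
  IsHole G H ∧ x ∉ H ∧ 3 ≤ (holeNbrs G H x).ncard

def IsTwinWheel {α : Type} (G : SimpleGraph α) (H : Set α) (x : α) : Prop :=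
  IsWheel G H x ∧ ∃ p q r : α, p ≠ q ∧ q ≠ r ∧ p ≠ r ∧
    holeNbrs G H x = {p, q, r} ∧ G.Adj p q ∧ G.Adj q r ∧ ¬ G.Adj p r

def IsShortPyramid {α : Type} (G : SimpleGraph α) (H : Set α) (x : α) : Prop :=
  IsWheel G H x ∧ ∃ p q r : α, p ≠ q ∧ q ≠ r ∧ p ≠ r ∧
    holeNbrs G H x = {p, q, r} ∧ G.Adj p q ∧ ¬ G.Adj q r ∧ ¬ G.Adj p r

def IsProperWheel {α : Type} (G : SimpleGraph α) (H : Set α) (x : α) : Prop :=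
  IsWheel G H x ∧ ¬ IsTwinWheel G H x ∧ ¬ IsShortPyramid G H x

/-- `x` is a hub of the induced subgraph `G[W]`. -/
def IsHubIn {α : Type} (G : SimpleGraph α) (W : Set α) (x : α) : Prop :=
  x ∈ W ∧ ∃ H : Set α, H ⊆ W ∧ IsProperWheel G H x

/-- `x` is a hub of `G`: the center of some proper wheel. -/
def IsHub {α : Type} (G : SimpleGraph α) (x : α) : Prop :=
  ∃ H : Set α, IsProperWheel G H x

/-- membership in the class `𝒞` of (C₄, theta, prism, even wheel)-free graphs. -/
def MemC {α : Type} (G : SimpleGraph α) : Prop :=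
  (∀ H : Set α, IsHole G H → H.ncard ≠ 4) ∧ ¬ HasTheta G ∧ ¬ HasPrism G ∧
    (∀ (H : Set α) (x : α), IsWheel G H x → ¬ Even (holeNbrs G H x).ncard)

/-- membership in the class `𝒞ₜ`: graphs in `𝒞` with no clique of size `t`. -/
def MemCt {α : Type} (t : ℕ) (G : SimpleGraph α) : Prop :=
  MemC G ∧ G.CliqueFree t

/-- `G` contains a generalized `k`-pyramid as an induced subgraph. -/
def ContainsGenPyramid {α : Type} (G : SimpleGraph α) (k : ℕ) : Prop :=
  ∃ (nP nQ : ℕ) (P : Fin nP → α) (Q : Fin nQ → α)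
    (m : Fin k → ℕ) (R : ∀ i, Fin (m i) → α) (xI zI : Fin k → ℕ),
    4 ≤ nP + nQ ∧ 1 ≤ nP ∧ 1 ≤ nQ ∧
    IsPathEmb G nP P ∧ IsPathEmb G nQ Q ∧
    (∀ i j, P i ≠ Q j) ∧
    (∀ (i : Fin nP) (j : Fin nQ), G.Adj (P i) (Q j) ↔
      ((i.val = 0 ∧ j.val = 0) ∨ (i.val = nP - 1 ∧ j.val = nQ - 1))) ∧
    (∀ i, 1 ≤ m i) ∧ (∀ i, IsPathEmb G (m i) (R i)) ∧
    (∀ i u j, R i u ≠ P j) ∧ (∀ i u j, R i u ≠ Q j) ∧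
    (∀ i i', i ≠ i' → ∀ u u', R i u ≠ R i' u' ∧ ¬ G.Adj (R i u) (R i' u')) ∧
    (∀ i, 0 < xI i ∧ xI i + 1 < nP - 1) ∧
    (∀ (i : Fin k) (u : Fin (m i)) (j : Fin nP), G.Adj (R i u) (P j) ↔
      (u.val = 0 ∧ (j.val = xI i ∨ j.val = xI i + 1))) ∧
    (∀ i, zI i < nQ) ∧
    (∀ (i : Fin k) (u : Fin (m i)) (j : Fin nQ), G.Adj (R i u) (Q j) ↔
      (u.val = m i - 1 ∧ j.val = zI i)) ∧
    (∀ i i' : Fin k, i < i' → xI i + 1 < xI i') ∧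
    (∀ i i' : Fin k, i ≤ i' → zI i ≤ zI i')

/-- membership in the class `𝒞ₜₜ`: graphs in `𝒞ₜ` with no induced generalized `t`-pyramid. -/
def MemCtt {α : Type} (t : ℕ) (G : SimpleGraph α) : Prop :=
  MemCt t G ∧ ¬ ContainsGenPyramid G t

/-- `(T, χ)` is a tree decomposition of `G`. -/
structure IsTD {α ι : Type} (G : SimpleGraph α) (T : SimpleGraph ι) (χ : ι → Set α) : Prop where
  finite : Finite ι
  isTree : T.IsTree
  memBag : ∀ v : α, ∃ t, v ∈ χ t
  edgeBag : ∀ ⦃u v : α⦄, G.Adj u v → ∃ t, u ∈ χ t ∧ v ∈ χ t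
  subtree : ∀ v : α, (T.induce {t | v ∈ χ t}).Connected

/-- `G` has a tree decomposition of width at most `w`. -/
def TwLE {α : Type} (G : SimpleGraph α) (w : ℕ) : Prop :=
  ∃ (ι : Type) (T : SimpleGraph ι) (χ : ι → Set α),
    IsTD G T χ ∧ ∀ t, (χ t).ncard ≤ w + 1

/-- The treewidth of `G`. -/
noncomputable def treeWidth {α : Type} (G : SimpleGraph α) : ℕ :=
  sInf {w | TwLE G w}

/-- For adjacent `t, t'` in a tree `T`, the vertex set of the component of `T - t`
containing `t'`. -/
def branchSet {ι : Type} (T : SimpleGraph ι) (t t' : ι) : Set ι :=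
  {s | ∀ w : T.Walk s t, t' ∈ w.support}

/-- The vertex set of `G_{t → t'}`: the union of the bags over the component of `T - t`
containing `t'`. -/
def sideSet {α ι : Type} (T : SimpleGraph ι) (χ : ι → Set α) (t t' : ι) : Set α :=
  ⋃ s ∈ branchSet T t t', χ s

/-- `(T, χ)` is a tight tree decomposition of `G`. -/
def TightTD {α ι : Type} (G : SimpleGraph α) (T : SimpleGraph ι) (χ : ι → Set α) : Prop :=
  IsTD G T χ ∧ ∀ ⦃t t' : ι⦄, T.Adj t t' →
    ∃ D, IsCompOf G (sideSet T χ t t' \ χ t) D ∧ setNbhd G D = χ t ∩ χ t'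

/-- `G` admits a clique cutset. -/
def HasCliqueCutset {α : Type} (G : SimpleGraph α) : Prop :=
  ∃ C : Set α, G.IsClique C ∧ ¬ (G.induce (Set.univ \ C)).Preconnected

/-- `G` is chordal: it has no hole. -/
def ChordalG {α : Type} (G : SimpleGraph α) : Prop := ∀ H : Set α, ¬ IsHole G H

/-- `G'` is a minimal chordal completion of `G`. -/
def IsMinChordalCompletion {α : Type} (G G' : SimpleGraph α) : Prop :=
  G ≤ G' ∧ ChordalG G' ∧ ∀ G'', G ≤ G'' → G'' ≤ G' → ChordalG G'' → G'' = G'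

/-- `Ω` is a potential maximal clique of `G` : a maximal clique of some minimal chordal
completion of `G`. -/
def IsPMC {α : Type} (G : SimpleGraph α) (Ω : Set α) : Prop :=
  ∃ G' : SimpleGraph α, IsMinChordalCompletion G G' ∧ G'.IsClique Ω ∧
    ∀ Ω' : Set α, G'.IsClique Ω' → Ω ⊆ Ω' → Ω' = Ω

/-- `(T, χ)` is a structured tree decomposition: every bag is a PMC of `G`. -/
def StructuredTD {α ι : Type} (G : SimpleGraph α) (T : SimpleGraph ι) (χ : ι → Set α) : Prop :=
  IsTD G T χ ∧ ∀ t, IsPMC G (χ t)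

/-- the decomposition has adhesion less than `m`. -/
def AdhLT {α ι : Type} (T : SimpleGraph ι) (χ : ι → Set α) (m : ℕ) : Prop :=
  ∀ ⦃t t' : ι⦄, T.Adj t t' → (χ t ∩ χ t').ncard < m

/-- `fatness χ i` is the number of bags of size `i`. -/
noncomputable def fatness {α ι : Type} (χ : ι → Set α) (i : ℕ) : ℕ :=
  {t : ι | (χ t).ncard = i}.ncard

/-- Lexicographic comparison of fatness vectors `(aₙ, …, a₀)` (larger sizes more
significant). -/
def FatLexLE (f g : ℕ → ℕ) : Prop :=
  (∀ i, f i = g i) ∨ ∃ j, f j < g j ∧ ∀ i, j < i → f i = g i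

/-- `(T, χ)` is an `m`-atomic tree decomposition of `G`: its adhesion is less than `m` and its
fatness is lexicographically minimum among all tree decompositions with adhesion less than `m`. -/
def IsAtomicTD {α ι : Type} (m : ℕ) (G : SimpleGraph α) (T : SimpleGraph ι)
    (χ : ι → Set α) : Prop :=
  IsTD G T χ ∧ AdhLT T χ m ∧
    ∀ (ι' : Type) (T' : SimpleGraph ι') (χ' : ι' → Set α),
      IsTD G T' χ' → AdhLT T' χ' m → FatLexLE (fatness χ) (fatness χ')

/-- Adjacency in the torso at the node `x` of the tree decomposition. -/
def torsoAdj {α ι : Type} (G : SimpleGraph α) (T : SimpleGraph ι) (χ : ι → Set α)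
    (x : ι) (u v : α) : Prop :=
  u ∈ χ x ∧ v ∈ χ x ∧ u ≠ v ∧
    (G.Adj u v ∨ ∃ y, T.Adj x y ∧ u ∈ χ y ∧ v ∈ χ y)

/-- The degree of `u` in the torso at `x`. -/
noncomputable def torsoDeg {α ι : Type} (G : SimpleGraph α) (T : SimpleGraph ι)
    (χ : ι → Set α) (x : ι) (u : α) : ℕ :=
  {v | torsoAdj G T χ x u v}.ncard

/-- `u` and `v` lie in the same component of `G[S]`. -/
def SameComp {α : Type} (G : SimpleGraph α) (S : Set α) (u v : α) : Prop :=
  ∃ (hu : u ∈ S) (hv : v ∈ S), (G.induce S).Reachable ⟨u, hu⟩ ⟨v, hv⟩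

/-- `X` is a minimal separator of `G`. -/
def IsMinimalSeparator {α : Type} (G : SimpleGraph α) (X : Set α) : Prop :=
  ∃ u v : α, u ∉ X ∧ v ∉ X ∧ ¬ SameComp G (Set.univ \ X) u v ∧
    ∀ Y : Set α, Y ⊂ X → SameComp G (Set.univ \ Y) u v
/-- The degree of `v` in `H` (as the cardinality of its neighbor set). -/
noncomputable def degreeSet {α : Type} (H : SimpleGraph α) (v : α) : ℕ :=
  (H.neighborSet v).ncard

/-- `H` is a path (as a graph). -/
def IsPathGraph {α : Type} (H : SimpleGraph α) : Prop :=
  ∃ (n : ℕ) (f : Fin n → α), Function.Bijective f ∧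
    ∀ i j, H.Adj (f i) (f j) ↔ (i.val = j.val + 1 ∨ j.val = i.val + 1)

/-- `H` is a caterpillar: a tree of maximum degree three having a path containing all
branch vertices. -/
def IsCaterpillar {α : Type} (H : SimpleGraph α) : Prop :=
  H.IsTree ∧ (∀ v, degreeSet H v ≤ 3) ∧
    ∃ (n : ℕ) (f : Fin n → α), IsPathEmb H n f ∧
      ∀ v, 2 < degreeSet H v → v ∈ Set.range f

/-- `H` is a subdivided star: a tree with exactly one branch vertex (its root), of degree
at least 3. -/
def IsSubdividedStar {α : Type} (H : SimpleGraph α) : Prop :=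
  H.IsTree ∧ ∃! r, 2 < degreeSet H r

/-- `H` is (isomorphic to) the line graph of a caterpillar. -/
def IsLineGraphOfCaterpillar {α : Type} (H : SimpleGraph α) : Prop :=
  ∃ (β : Type) (C : SimpleGraph β), IsCaterpillar C ∧
    Nonempty (SimpleGraph.Iso H C.lineGraph)

/-- `w` is a simplicial vertex of the induced subgraph `G[W]`. -/
def SimplicialIn {α : Type} (G : SimpleGraph α) (W : Set α) (w : α) : Prop :=
  w ∈ W ∧ G.IsClique {u | u ∈ W ∧ G.Adj w u}

/-- `(p, x)` is an alignment: `p` enumerates an induced path, `x` enumerates the set `X`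
in the order given by the alignment. -/
structure IsAlignment {α : Type} (G : SimpleGraph α) (n : ℕ) (p : Fin n → α)
    (k : ℕ) (x : Fin k → α) : Prop where
  hn : 1 ≤ n
  hk : 2 ≤ k
  path : IsPathEmb G n p
  injx : Function.Injective x
  disj : ∀ i j, x i ≠ p j
  cover : ∀ i, ∃ j, G.Adj (x i) (p j)
  first : ∀ j : Fin n, G.Adj (x ⟨0, by omega⟩) (p j) ↔ j.val = 0
  last : ∀ j : Fin n, G.Adj (x ⟨k - 1, by omega⟩) (p j) ↔ j.val = n - 1
  ordered : ∀ (i i' : Fin k) (j j' : Fin n),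
    i < i' → G.Adj (x i) (p j) → G.Adj (x i') (p j') → j < j'

/-- A wide alignment: every middle vertex of `X` has two non-adjacent neighbors in `P`. -/
def IsWideAlignment {α : Type} (G : SimpleGraph α) (n : ℕ) (p : Fin n → α)
    (k : ℕ) (x : Fin k → α) : Prop :=
  IsAlignment G n p k x ∧ ∀ i : Fin k, 0 < i.val → i.val < k - 1 →
    ∃ j j' : Fin n, j.val + 1 < j'.val ∧ G.Adj (x i) (p j) ∧ G.Adj (x i) (p j')

/-- A spiky alignment: every middle vertex of `X` has a unique neighbor in `P`. -/
def IsSpikyAlignment {α : Type} (G : SimpleGraph α) (n : ℕ) (p : Fin n → α)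
    (k : ℕ) (x : Fin k → α) : Prop :=
  IsAlignment G n p k x ∧ ∀ i : Fin k, 0 < i.val → i.val < k - 1 →
    ∃! j : Fin n, G.Adj (x i) (p j)

/-- A triangular alignment: every middle vertex of `X` has exactly two neighbors in `P`,
and they are adjacent. -/
def IsTriangularAlignment {α : Type} (G : SimpleGraph α) (n : ℕ) (p : Fin n → α)
    (k : ℕ) (x : Fin k → α) : Prop :=
  IsAlignment G n p k x ∧ ∀ i : Fin k, 0 < i.val → i.val < k - 1 →
    ∃ j : Fin n, j.val + 1 < n ∧
      ∀ j' : Fin n, G.Adj (x i) (p j') ↔ (j'.val = j.val ∨ j'.val = j.val + 1)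

/-- `(H, x)` is a spiky connectifier: `H` is an induced caterpillar with spine `p` and legs
`ℓ`, and `x` enumerates `X` in the order given by the connectifier (`x 0` and `x (k-1)`
attached at the ends of the spine, the others to the tips of the legs, in the order in which
the legs attach along the spine). -/
def IsSpikyConnectifier {α : Type} (G : SimpleGraph α) (H : Set α)
    (k : ℕ) (x : Fin k → α) : Prop :=
  ∃ (hk : 2 ≤ k) (n : ℕ) (_ : 2 ≤ n) (p : Fin n → α)
    (m : Fin (k - 2) → ℕ) (ℓ : ∀ i, Fin (m i) → α) (a : Fin (k - 2) → ℕ),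
    IsPathEmb G n p ∧ (∀ i, 1 ≤ m i) ∧ (∀ i, IsPathEmb G (m i) (ℓ i)) ∧
    H = Set.range p ∪ ⋃ i, Set.range (ℓ i) ∧
    Function.Injective x ∧ (∀ i, x i ∉ H) ∧
    (∀ i j j', ℓ i j ≠ p j') ∧
    (∀ i i', i ≠ i' → ∀ j j', ℓ i j ≠ ℓ i' j' ∧ ¬ G.Adj (ℓ i j) (ℓ i' j')) ∧
    (∀ i, 0 < a i ∧ a i < n - 1) ∧
    (∀ i i', i < i' → a i < a i') ∧
    (∀ (i : Fin (k - 2)) (j : Fin (m i)) (j' : Fin n),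
      G.Adj (ℓ i j) (p j') ↔ (j.val = 0 ∧ j'.val = a i)) ∧
    (∀ j : Fin n, G.Adj (x ⟨0, by omega⟩) (p j) ↔ j.val = 0) ∧
    (∀ (i : Fin (k - 2)) (j : Fin (m i)), ¬ G.Adj (x ⟨0, by omega⟩) (ℓ i j)) ∧
    (∀ j : Fin n, G.Adj (x ⟨k - 1, by omega⟩) (p j) ↔ j.val = n - 1) ∧
    (∀ (i : Fin (k - 2)) (j : Fin (m i)), ¬ G.Adj (x ⟨k - 1, by omega⟩) (ℓ i j)) ∧
    (∀ (i : Fin (k - 2)) (j : Fin n),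
      ¬ G.Adj (x ⟨i.val + 1, by have := i.isLt; omega⟩) (p j)) ∧
    (∀ (i i' : Fin (k - 2)) (j : Fin (m i')),
      G.Adj (x ⟨i.val + 1, by have := i.isLt; omega⟩) (ℓ i' j) ↔ (i' = i ∧ j.val = m i' - 1))

/-- `(H, x)` is a triangular connectifier: `H` is the line graph of a caterpillar, with
spine `p` and legs `ℓ` attached along triangles, and `x` enumerates `X` in the order given
by the connectifier. -/
def IsTriangularConnectifier {α : Type} (G : SimpleGraph α) (H : Set α)
    (k : ℕ) (x : Fin k → α) : Prop :=
  ∃ (hk : 2 ≤ k) (n : ℕ) (_ : 2 ≤ n) (p : Fin n → α)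
    (m : Fin (k - 2) → ℕ) (ℓ : ∀ i, Fin (m i) → α) (a : Fin (k - 2) → ℕ),
    IsPathEmb G n p ∧ (∀ i, 1 ≤ m i) ∧ (∀ i, IsPathEmb G (m i) (ℓ i)) ∧
    H = Set.range p ∪ ⋃ i, Set.range (ℓ i) ∧
    Function.Injective x ∧ (∀ i, x i ∉ H) ∧
    (∀ i j j', ℓ i j ≠ p j') ∧
    (∀ i i', i ≠ i' → ∀ j j', ℓ i j ≠ ℓ i' j' ∧ ¬ G.Adj (ℓ i j) (ℓ i' j')) ∧
    (∀ i, a i + 1 ≤ n - 1) ∧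
    (∀ i i', i < i' → a i < a i') ∧
    (∀ (i : Fin (k - 2)) (j : Fin (m i)) (j' : Fin n),
      G.Adj (ℓ i j) (p j') ↔ (j.val = 0 ∧ (j'.val = a i ∨ j'.val = a i + 1))) ∧
    (∀ j : Fin n, G.Adj (x ⟨0, by omega⟩) (p j) ↔ j.val = 0) ∧
    (∀ (i : Fin (k - 2)) (j : Fin (m i)), ¬ G.Adj (x ⟨0, by omega⟩) (ℓ i j)) ∧
    (∀ j : Fin n, G.Adj (x ⟨k - 1, by omega⟩) (p j) ↔ j.val = n - 1) ∧
    (∀ (i : Fin (k - 2)) (j : Fin (m i)), ¬ G.Adj (x ⟨k - 1, by omega⟩) (ℓ i j)) ∧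
    (∀ (i : Fin (k - 2)) (j : Fin n),
      ¬ G.Adj (x ⟨i.val + 1, by have := i.isLt; omega⟩) (p j)) ∧
    (∀ (i i' : Fin (k - 2)) (j : Fin (m i')),
      G.Adj (x ⟨i.val + 1, by have := i.isLt; omega⟩) (ℓ i' j) ↔ (i' = i ∧ j.val = m i' - 1))

/-- `(H, x)` is a stellar connectifier: `H` is an induced subdivided star with root `r` and
legs `ℓ`, and the vertices of `X` are attached to the tips of the legs. -/
def IsStellarConnectifier {α : Type} (G : SimpleGraph α) (H : Set α)
    (k : ℕ) (x : Fin k → α) : Prop :=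
  ∃ (_ : 3 ≤ k) (r : α) (m : Fin k → ℕ) (ℓ : ∀ i, Fin (m i) → α),
    (∀ i, 1 ≤ m i) ∧ (∀ i, IsPathEmb G (m i) (ℓ i)) ∧
    H = {r} ∪ ⋃ i, Set.range (ℓ i) ∧
    Function.Injective x ∧ (∀ i, x i ∉ H) ∧
    (∀ i j, ℓ i j ≠ r) ∧
    (∀ i i', i ≠ i' → ∀ j j', ℓ i j ≠ ℓ i' j' ∧ ¬ G.Adj (ℓ i j) (ℓ i' j')) ∧
    (∀ (i : Fin k) (j : Fin (m i)), G.Adj r (ℓ i j) ↔ j.val = 0) ∧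
    (∀ i, ¬ G.Adj (x i) r) ∧
    (∀ (i i' : Fin k) (j : Fin (m i')),
      G.Adj (x i) (ℓ i' j) ↔ (i' = i ∧ j.val = m i' - 1))

/-- `(H, X)` is a wide alignment (set version). -/
def IsWideAlignSet {α : Type} (G : SimpleGraph α) (H X : Set α) : Prop :=
  ∃ (n k : ℕ) (p : Fin n → α) (e : Fin k → α),
    H = Set.range p ∧ X = Set.range e ∧ IsWideAlignment G n p k e

/-- `(H, X)` is a spiky alignment (set version). -/
def IsSpikyAlignSet {α : Type} (G : SimpleGraph α) (H X : Set α) : Prop :=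
  ∃ (n k : ℕ) (p : Fin n → α) (e : Fin k → α),
    H = Set.range p ∧ X = Set.range e ∧ IsSpikyAlignment G n p k e

/-- `(H, X)` is a triangular alignment (set version). -/
def IsTriAlignSet {α : Type} (G : SimpleGraph α) (H X : Set α) : Prop :=
  ∃ (n k : ℕ) (p : Fin n → α) (e : Fin k → α),
    H = Set.range p ∧ X = Set.range e ∧ IsTriangularAlignment G n p k e

/-- `(H, X)` is a spiky connectifier (set version). -/
def IsSpikyConnSet {α : Type} (G : SimpleGraph α) (H X : Set α) : Prop :=
  ∃ (k : ℕ) (e : Fin k → α), X = Set.range e ∧ IsSpikyConnectifier G H k e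

/-- `(H, X)` is a triangular connectifier (set version). -/
def IsTriConnSet {α : Type} (G : SimpleGraph α) (H X : Set α) : Prop :=
  ∃ (k : ℕ) (e : Fin k → α), X = Set.range e ∧ IsTriangularConnectifier G H k e

/-- `(H, X)` is a stellar connectifier (set version). -/
def IsStellarConnSet {α : Type} (G : SimpleGraph α) (H X : Set α) : Prop :=
  ∃ (k : ℕ) (e : Fin k → α), X = Set.range e ∧ IsStellarConnectifier G H k e

/-- `(H, X)` (with order `e` on `X`) is a consistent alignment or consistent connectifier. -/
def IsConsistentWith {α : Type} (G : SimpleGraph α) (H : Set α)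
    (k : ℕ) (e : Fin k → α) : Prop :=
  (∃ (n : ℕ) (p : Fin n → α), H = Set.range p ∧
    (IsWideAlignment G n p k e ∨ IsSpikyAlignment G n p k e ∨ IsTriangularAlignment G n p k e)) ∨
  IsSpikyConnectifier G H k e ∨ IsTriangularConnectifier G H k e ∨
    IsStellarConnectifier G H k e

section Connectivity

variable {α : Type} {G : SimpleGraph α}

theorem ConnSet.exists_walk {A : Set α} (hA : ConnSet G A) {x y : α} (hx : x ∈ A) (hy : y ∈ A) :
    ∃ p : G.Walk x y, p.IsPath ∧ ∀ z ∈ p.support, z ∈ A := by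
  classical
  obtain ⟨p, hp⟩ := hA.preconnected.exists_isPath ⟨x, hx⟩ ⟨y, hy⟩
  let q : G.Walk x y := p.map (SimpleGraph.Embedding.induce A).toHom
  have hq : q.support = p.support.map Subtype.val := SimpleGraph.Walk.support_map _ _
  refine ⟨q, ?_, fun z hz => ?_⟩
  · rw [SimpleGraph.Walk.isPath_def, hq]
    exact hp.support_nodup.map Subtype.val_injective
  · rw [hq, List.mem_map] at hz
    obtain ⟨z, -, rfl⟩ := hz
    exact z.2

/-- A connected set that meets `D` but not the neighborhood of `D` is contained in `D`. -/
theorem ConnSet.subset_of_disjoint_setNbhd {E D : Set α} (hE : ConnSet G E)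
    (hmeet : (E ∩ D).Nonempty) (hdisj : Disjoint E (setNbhd G D)) : E ⊆ D := by
  obtain ⟨x, hxE, hxD⟩ := hmeet
  intro y hy
  obtain ⟨p, -, hp⟩ := hE.exists_walk hxE hy
  clear hxE hy
  induction p with
  | nil => exact hxD
  | cons hadj p ih =>
    refine ih ?_ fun z hz => hp z (by simp [hz])
    by_contra hv
    exact Set.disjoint_left.mp hdisj (hp _ (by simp)) ⟨hv, _, hxD, hadj.symm⟩

/-- In a finite graph every connected subset of `S` lies in a component of `G[S]`. -/
theorem ConnSet.exists_isCompOf [Finite α] {S E : Set α} (hE : ConnSet G E) (hES : E ⊆ S) :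
    ∃ D, IsCompOf G S D ∧ E ⊆ D := by
  obtain ⟨D, hED, hD⟩ := Finite.exists_le_maximal
    (p := fun D : Set α => D ⊆ S ∧ ConnSet G D) ⟨hES, hE⟩
  exact ⟨D, ⟨hD.prop.1, hD.prop.2, fun D' h hS hc => (hD.le_of_ge ⟨hS, hc⟩ h).antisymm h⟩, hED⟩

theorem ConnSet.preimage_val {E D : Set α} (hE : ConnSet G E) (hED : E ⊆ D) :
    ConnSet (G.induce D) (Subtype.val ⁻¹' E) :=
  SimpleGraph.Connected.map (G := G.induce E)
    (H := (G.induce D).induce (Subtype.val ⁻¹' E))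
    ⟨fun x => ⟨⟨x, hED x.2⟩, x.2⟩, fun h => h⟩ (fun x => ⟨⟨x.1.1, x.2⟩, rfl⟩) hE

end Connectivity

section TreeDecomposition

variable {α ι : Type} {G : SimpleGraph α} {T : SimpleGraph ι} {χ : ι → Set α}

/-- A subtree `A` of a tree with root `r` has a top vertex `a`, and each path from `r` to a vertex
of `A` enters `A` at `a` and stays in `A` from there on. -/
theorem SimpleGraph.IsTree.exists_top (hT : T.IsTree) (r : ι) {A : Set ι} (hA : ConnSet T A) :
    ∃ d : ℕ, ∃ a ∈ A, ∀ x ∈ A, ∃ P : T.Walk r x, P.IsPath ∧ P.getVert d = a ∧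
      ∀ i, d ≤ i → P.getVert i ∈ A := by
  classical
  have hne : A.Nonempty := Set.nonempty_coe_sort.mp hA.nonempty
  obtain ⟨a, haA, hmin⟩ : ∃ a ∈ A, ∀ z ∈ A, T.dist r a ≤ T.dist r z := by
    obtain ⟨a, ha, h⟩ := (measure (T.dist r)).wf.has_min A hne
    exact ⟨a, ha, fun z hz => not_lt.mp (h z hz)⟩
  obtain ⟨p, hp, hlen⟩ := hT.connected.exists_path_of_dist r a
  refine ⟨p.length, a, haA, fun x hx => ?_⟩
  obtain ⟨q, hq, hqA⟩ := hA.exists_walk haA hx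
  refine ⟨p.append q, ?_, ?_, fun i hi => ?_⟩
  · rw [SimpleGraph.Walk.isPath_def, SimpleGraph.Walk.support_append, List.nodup_append']
    refine ⟨hp.support_nodup, hq.support_nodup.tail, fun z hzp hzq => ?_⟩
    have hza : z ≠ a := by
      rintro rfl
      have := hq.support_nodup
      rw [← SimpleGraph.Walk.cons_tail_support] at this
      exact (List.nodup_cons.mp this).1 hzq
    have h1 := hmin z (hqA z (List.mem_of_mem_tail hzq))
    have h2 := SimpleGraph.Walk.length_takeUntil_lt_length hzp hza
    have h3 := SimpleGraph.dist_le (p.takeUntil z hzp)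
    omega
  · simp [SimpleGraph.Walk.getVert_append]
  · rw [SimpleGraph.Walk.getVert_append, if_neg (by omega)]
    exact hqA _ (q.getVert_mem_support _)

/-- The Helly property for families of subtrees, indexed by the vertices of the tree. -/
theorem SimpleGraph.IsTree.exists_mem_of_pairwise_meet [Finite ι] (hT : T.IsTree)
    {A : ι → Set ι} (hA : ∀ t, ConnSet T (A t)) (hmeet : ∀ t t', (A t ∩ A t').Nonempty) :
    ∃ a, ∀ t, a ∈ A t := by
  obtain ⟨r⟩ := hT.connected.nonempty
  choose d a haA hP using fun t => hT.exists_top r (hA t)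
  have : Nonempty ι := ⟨r⟩
  obtain ⟨t, ht⟩ := Finite.exists_max d
  refine ⟨a t, fun t' => ?_⟩
  obtain ⟨x, hx, hx'⟩ := hmeet t t'
  obtain ⟨P, hPp, hPa, -⟩ := hP t x hx
  obtain ⟨Q, hQp, -, hQA⟩ := hP t' x hx'
  obtain rfl : P = Q := (hT.existsUnique_path r x).unique hPp hQp
  have hle := ht t'
  exact hPa ▸ hQA _ hle

/-- The nodes whose bags meet a given connected set induce a subtree. -/
theorem IsTD.connSet_nodes (h : IsTD G T χ) {D : Set α} (hD : ConnSet G D) :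
    ConnSet T {x | (χ x ∩ D).Nonempty} := by
  set A : Set ι := {x | (χ x ∩ D).Nonempty}
  have key : ∀ v ∈ D, ∀ x y (hx : v ∈ χ x) (hy : v ∈ χ y) (hxA : x ∈ A) (hyA : y ∈ A),
      (T.induce A).Reachable ⟨x, hxA⟩ ⟨y, hyA⟩ := by
    intro v hv x y hx hy hxA hyA
    exact ((h.subtree v).preconnected ⟨x, hx⟩ ⟨y, hy⟩).map
      (T.induceHomOfLE (s := {t | v ∈ χ t}) (s' := A) fun z hz => ⟨v, hz, hv⟩).toHom
  have walk : ∀ {u v : α} (p : G.Walk u v), (∀ z ∈ p.support, z ∈ D) →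
      ∀ x y (hx : u ∈ χ x) (hy : v ∈ χ y) (hxA : x ∈ A) (hyA : y ∈ A),
      (T.induce A).Reachable ⟨x, hxA⟩ ⟨y, hyA⟩ := by
    intro u v p
    induction p with
    | nil => intro hp x y hx hy hxA hyA; exact key _ (hp _ (by simp)) x y hx hy hxA hyA
    | cons hadj p ih =>
      intro hp x y hx hy hxA hyA
      obtain ⟨z, hz, hz'⟩ := h.edgeBag hadj
      have hzA : z ∈ A := ⟨_, hz, hp _ (by simp)⟩
      exact (key _ (hp _ (by simp)) x z hx hz hxA hzA).trans
        (ih (fun w hw => hp w (by simp [hw])) z y hz' hy hzA hyA)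
  obtain ⟨v, hv⟩ := Set.nonempty_coe_sort.mp hD.nonempty
  obtain ⟨x, hx⟩ := h.memBag v
  refine SimpleGraph.connected_iff _ |>.mpr ⟨?_, ⟨x, v, hx, hv⟩⟩
  rintro ⟨y, w, hyw, hw⟩ ⟨y', w', hyw', hw'⟩
  obtain ⟨p, -, hp⟩ := hD.exists_walk hw hw'
  exact walk p hp y y' hyw hyw' _ _

/-- Every tree decomposition of a finite graph has a bag that is a balanced separator. -/
theorem IsTD.exists_balanced_bag [Finite α] (h : IsTD G T χ) :
    ∃ t, ∀ E, ConnSet G E → Disjoint E (χ t) → 2 * E.ncard ≤ Nat.card α := by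
  by_contra! hcon
  choose E hE hdisj hbig using hcon
  have := h.finite
  obtain ⟨t, ht⟩ := h.isTree.exists_mem_of_pairwise_meet (fun t => h.connSet_nodes (hE t)) (by
    intro t t'
    obtain ⟨v, hv, hv'⟩ : (E t ∩ E t').Nonempty := by
      by_contra hemp
      have h1 := Set.ncard_union_eq
        (Set.disjoint_iff_inter_eq_empty.mpr (Set.not_nonempty_iff_eq_empty.mp hemp))
      have h2 := Set.ncard_le_card (E t ∪ E t')
      have h3 := hbig t
      have h4 := hbig t'
      omega
    obtain ⟨x, hx⟩ := h.memBag v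
    exact ⟨x, ⟨v, hx, hv⟩, ⟨v, hx, hv'⟩⟩)
  obtain ⟨v, hv, hv'⟩ := ht t
  exact Set.disjoint_left.mp (hdisj t) hv' hv

theorem twLE_treeWidth (G : SimpleGraph α) : TwLE G (treeWidth G) := by
  refine Nat.sInf_mem (s := {w | TwLE G w}) ⟨(Set.univ : Set α).ncard, Unit, ⊥,
    fun _ => Set.univ, ⟨inferInstance, .of_subsingleton, fun _ => ⟨(), trivial⟩,
      fun _ _ _ => ⟨(), trivial, trivial⟩, fun v => ?_⟩, fun _ => Nat.le_succ _⟩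
  have : Nonempty ↑{t : Unit | v ∈ (Set.univ : Set α)} := ⟨⟨(), trivial⟩⟩
  exact (SimpleGraph.connected_iff _).mpr ⟨.of_subsingleton, this⟩

theorem exists_balanced_separator_of_treeWidth_le [Finite α] {w : ℕ} (hw : treeWidth G ≤ w) :
    ∃ Y : Set α, Y.ncard ≤ w + 1 ∧
      ∀ E, ConnSet G E → Disjoint E Y → 2 * E.ncard ≤ Nat.card α := by
  obtain ⟨ι, T, χ, hTD, hle⟩ := twLE_treeWidth G
  obtain ⟨t, ht⟩ := hTD.exists_balanced_bag
  exact ⟨χ t, (hle t).trans (by omega), ht⟩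

end TreeDecomposition

section InducedSubgraph

variable {α β : Type} {G : SimpleGraph α} {G' : SimpleGraph β}

theorem IsPathEmb.map (φ : G' ↪g G) {n : ℕ} {f : Fin n → β} (h : IsPathEmb G' n f) :
    IsPathEmb G n (φ ∘ f) :=
  ⟨φ.injective.comp h.1, fun i j => φ.map_adj_iff.trans (h.2 i j)⟩

theorem IsPathFromTo.map (φ : G' ↪g G) {n : ℕ} {f : Fin n → β} {a b : β}
    (h : IsPathFromTo G' n f a b) : IsPathFromTo G n (φ ∘ f) (φ a) (φ b) := by
  obtain ⟨hp, hn, rfl, rfl⟩ := h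
  exact ⟨hp.map φ, hn, rfl, rfl⟩

theorem IsHole.map (φ : G' ↪g G) {H : Set β} (h : IsHole G' H) : IsHole G (φ '' H) := by
  obtain ⟨n, f, hn, hf, rfl⟩ := h
  exact ⟨n, φ ∘ f, hn, ⟨φ.injective.comp hf.1, fun i j => φ.map_adj_iff.trans (hf.2 i j)⟩,
    Set.range_comp φ f⟩

theorem HasTheta.map (φ : G' ↪g G) (h : HasTheta G') : HasTheta G := by
  obtain ⟨a, b, n, f, hab, hadj, hn, hp, hd⟩ := h
  refine ⟨φ a, φ b, n, fun i => φ ∘ f i, φ.injective.ne hab, φ.map_adj_iff.not.mpr hadj, hn,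
    fun i => (hp i).map φ, fun i j hij u v hu hu' hv hv' => ?_⟩
  obtain ⟨h1, h2⟩ := hd i j hij u v hu hu' hv hv'
  exact ⟨φ.injective.ne h1, φ.map_adj_iff.not.mpr h2⟩

theorem HasPrism.map (φ : G' ↪g G) (h : HasPrism G') : HasPrism G := by
  obtain ⟨n, f, hn, hp, hd, ha⟩ := h
  exact ⟨n, fun i => φ ∘ f i, hn, fun i => (hp i).map φ,
    fun i j hij u v => φ.injective.ne (hd i j hij u v),
    fun i j hij u v => φ.map_adj_iff.trans (ha i j hij u v)⟩

theorem holeNbrs_image (φ : G' ↪g G) (H : Set β) (x : β) :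
    holeNbrs G (φ '' H) (φ x) = φ '' holeNbrs G' H x := by
  ext v
  constructor
  · rintro ⟨⟨v, hv, rfl⟩, hadj⟩
    exact ⟨v, ⟨hv, φ.map_adj_iff.mp hadj⟩, rfl⟩
  · rintro ⟨v, ⟨hv, hadj⟩, rfl⟩
    exact ⟨⟨v, hv, rfl⟩, φ.map_adj_iff.mpr hadj⟩

theorem ncard_holeNbrs_image (φ : G' ↪g G) (H : Set β) (x : β) :
    (holeNbrs G (φ '' H) (φ x)).ncard = (holeNbrs G' H x).ncard := by
  rw [holeNbrs_image, Set.ncard_image_of_injective _ φ.injective]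

theorem IsWheel.map (φ : G' ↪g G) {H : Set β} {x : β} (h : IsWheel G' H x) :
    IsWheel G (φ '' H) (φ x) :=
  ⟨h.1.map φ, fun hx => h.2.1 ((φ.injective.mem_set_image).mp hx),
    (ncard_holeNbrs_image φ H x).symm ▸ h.2.2⟩

theorem exists_eq_of_image_eq_triple (φ : G' ↪g G) {A : Set β} {p q r : α}
    (h : φ '' A = {p, q, r}) :
    ∃ p' q' r', φ p' = p ∧ φ q' = q ∧ φ r' = r ∧ A = {p', q', r'} := by
  obtain ⟨p', -, rfl⟩ : p ∈ φ '' A := h ▸ by simp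
  obtain ⟨q', -, rfl⟩ : q ∈ φ '' A := h ▸ by simp
  obtain ⟨r', -, rfl⟩ : r ∈ φ '' A := h ▸ by simp
  refine ⟨p', q', r', rfl, rfl, rfl, φ.injective.image_injective ?_⟩
  simpa [Set.image_insert_eq] using h

theorem IsProperWheel.map (φ : G' ↪g G) {H : Set β} {x : β} (h : IsProperWheel G' H x) :
    IsProperWheel G (φ '' H) (φ x) := by
  obtain ⟨hw, htwin, hpyr⟩ := h
  refine ⟨hw.map φ, ?_, ?_⟩
  · rintro ⟨-, p, q, r, h1, h2, h3, hN, h4, h5, h6⟩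
    rw [holeNbrs_image] at hN
    obtain ⟨p, q, r, rfl, rfl, rfl, hN'⟩ := exists_eq_of_image_eq_triple φ hN
    rw [φ.map_adj_iff] at h4 h5 h6
    exact htwin ⟨hw, p, q, r, ne_of_apply_ne φ h1, ne_of_apply_ne φ h2, ne_of_apply_ne φ h3,
      hN', h4, h5, h6⟩
  · rintro ⟨-, p, q, r, h1, h2, h3, hN, h4, h5, h6⟩
    rw [holeNbrs_image] at hN
    obtain ⟨p, q, r, rfl, rfl, rfl, hN'⟩ := exists_eq_of_image_eq_triple φ hN
    rw [φ.map_adj_iff] at h4 h5 h6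
    exact hpyr ⟨hw, p, q, r, ne_of_apply_ne φ h1, ne_of_apply_ne φ h2, ne_of_apply_ne φ h3,
      hN', h4, h5, h6⟩

/-- The class `𝒞ₜ` is closed under induced subgraphs. -/
theorem MemCt.of_embedding (φ : G' ↪g G) {t : ℕ} (h : MemCt t G) : MemCt t G' := by
  obtain ⟨⟨h4, hθ, hπ, hw⟩, hcl⟩ := h
  refine ⟨⟨fun H hH => ?_, fun h => hθ (h.map φ), fun h => hπ (h.map φ), fun H x hx => ?_⟩,
    hcl.comap ⟨φ.toCopy⟩⟩
  · exact Set.ncard_image_of_injective H φ.injective ▸ h4 _ (hH.map φ)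
  · exact ncard_holeNbrs_image φ H x ▸ hw _ _ (hx.map φ)

theorem IsHub.isHubIn_of_induce {D W : Set α} (hDW : D ⊆ W) {x : D}
    (h : IsHub (G.induce D) x) : IsHubIn G W x := by
  obtain ⟨H, hH⟩ := h
  refine ⟨hDW x.2, _, ?_, hH.map (SimpleGraph.Embedding.induce D)⟩
  rintro _ ⟨v, -, rfl⟩
  exact hDW v.2

end InducedSubgraph

/-- An induced subgraph `G[D]` of treewidth at most `w` has a balanced separator of size at most
`w + 1`. -/
theorem exists_balanced_separator_induce {α : Type} [Finite α] {G : SimpleGraph α} {D : Set α}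
    {w : ℕ} (hw : treeWidth (G.induce D) ≤ w) :
    ∃ Y ⊆ D, Y.ncard ≤ w + 1 ∧
      ∀ E, ConnSet G E → E ⊆ D → Disjoint E Y → 2 * E.ncard ≤ D.ncard := by
  obtain ⟨Y, hY, hbal⟩ := exists_balanced_separator_of_treeWidth_le hw
  refine ⟨Subtype.val '' Y, by simp,
    (Set.ncard_image_of_injective _ Subtype.val_injective).trans_le hY,
    fun E hE hED hEY => ?_⟩
  have hcard : (Subtype.val ⁻¹' E : Set D).ncard = E.ncard := by
    rw [← Set.ncard_image_of_injective _ Subtype.val_injective, Subtype.image_preimage_coe,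
      Set.inter_eq_right.mpr hED]
  have := hbal _ (hE.preimage_val hED) (Set.disjoint_left.mpr fun y hyE hyY =>
    Set.disjoint_left.mp hEY hyE ⟨y, hyY, rfl⟩)
  rwa [hcard, Nat.card_coe_set_eq] at this

/-- properties of vertices of `S ∩ χ(t0)` with respect to the graph `β`. -/
theorem stmt_19 {V ι : Type} [Fintype V]
    (t d m γ : ℕ) (ht : 1 ≤ t) (hd : 1 ≤ d) (hm : 1 ≤ m) (hγ : 1 ≤ γ)
    (G : SimpleGraph V) (hG : MemCt t G) (hcc : ¬ HasCliqueCutset G)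
    (T : SimpleGraph ι) (χ : ι → Set V) (hT : IsTD G T χ) (t0 : ι)
    (Conn : ι → Set V)
    (hConn : ∀ t1 : ι, T.Adj t0 t1 →
      Conn t1 ⊆ sideSet T χ t0 t1 ∧
      χ t0 ∩ χ t1 ⊆ Conn t1 ∧
      ConnSet G (Conn t1 \ χ t0) ∧
      setNbhd G (Conn t1 \ χ t0) = χ t0 ∩ χ t1 ∧
      (∀ v ∈ Conn t1 \ χ t0,
        ¬ IsHubIn G ((Set.univ \ sideSet T χ t0 t1) ∪ Conn t1) v))
    (hγprop : ∀ (W : Type) [Fintype W], ∀ G' : SimpleGraph W,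
      MemCt t G' → (∀ w : W, ¬ IsHub G' w) → treeWidth G' ≤ γ)
    (S' : Set V) (hS'hub : ∀ s ∈ S', IsHub G s) (hS'stable : StableSet G S')
    (S Sbad B : Set V)
    (hS : S = {s ∈ S' | s ∉ χ t0 ∨ torsoDeg G T χ t0 s < 2 * m * (m - 1)})
    (hSbad : Sbad = S' \ S)
    (hB : B = (χ t0 ∪ ⋃ t1 ∈ {t1 : ι | T.Adj t0 t1}, Conn t1) \ Sbad)
    (hbal : ¬ ∃ X : Set V, X ⊆ B ∧ X.ncard ≤ 2 * m * (m - 1) + γ + 1 ∧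
      ∀ D : Set V, IsCompOf G (B \ X) D → 2 * D.ncard ≤ B.ncard)
    (s : V) (hs : s ∈ S ∩ χ t0) :
    torsoDeg G T χ t0 s < 2 * m * (m - 1) ∧
    {v ∈ χ t0 | G.Adj s v}.ncard < 2 * m * (m - 1) ∧
    ∃ D : Set V, IsCompOf G (B \ {v ∈ B | v = s ∨ G.Adj s v}) D ∧
      B.ncard < 2 * D.ncard := by
  have hdeg : torsoDeg G T χ t0 s < 2 * m * (m - 1) := by
    obtain ⟨hsS, hst⟩ := hs
    rw [hS] at hsS
    exact hsS.2.resolve_left fun h => h hst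
  have hsχ : s ∈ χ t0 := hs.2
  refine ⟨hdeg, (Set.ncard_le_ncard ?_).trans_lt hdeg, ?_⟩
  · exact fun v ⟨hv, hadj⟩ => ⟨hsχ, hv, hadj.ne, .inl hadj⟩
  by_contra! hcon
  set X₀ : Set V := insert s {v | torsoAdj G T χ t0 s v} with hX₀
  have hX₀card : X₀.ncard ≤ 2 * m * (m - 1) := (Set.ncard_insert_le _ _).trans hdeg
  have hSbadχ : Sbad ⊆ χ t0 := by
    rintro v hv
    rw [hSbad, hS] at hv
    by_contra hvχ
    exact hv.2 ⟨hv.1, .inl hvχ⟩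
  have hside : ∀ t1, T.Adj t0 t1 → Conn t1 \ χ t0 ⊆ B := by
    intro t1 h1 v hv
    rw [hB]
    exact ⟨.inr (Set.mem_biUnion h1 hv.1), fun h => hv.2 (hSbadχ h)⟩
  -- after deleting `X₀`, a side attached at `s` is cut off from the rest of `B`
  have hcut : ∀ t1, T.Adj t0 t1 → s ∈ χ t1 → ∀ E, ConnSet G E → Disjoint E (X₀ ∩ B) → E ⊆ B →
      (E ∩ (Conn t1 \ χ t0)).Nonempty → E ⊆ Conn t1 \ χ t0 := by
    intro t1 h1 hs1 E hE hEX hEB hmeet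
    refine hE.subset_of_disjoint_setNbhd hmeet (Set.disjoint_left.mpr fun v hvE hv => ?_)
    rw [(hConn t1 h1).2.2.2.1] at hv
    refine Set.disjoint_left.mp hEX hvE ⟨?_, hEB hvE⟩
    by_cases hvs : v = s
    · exact .inl hvs
    · exact .inr ⟨hsχ, hv.1, Ne.symm hvs, .inr ⟨t1, h1, hs1, hv.2⟩⟩
  by_cases hlarge : ∃ t1, T.Adj t0 t1 ∧ s ∈ χ t1 ∧ B.ncard < 2 * (Conn t1 \ χ t0).ncard
  · obtain ⟨t1, h1, hs1, hlarge⟩ := hlarge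
    set D := Conn t1 \ χ t0 with hD
    have htw : treeWidth (G.induce D) ≤ γ := by
      classical
      refine hγprop _ _ (hG.of_embedding (SimpleGraph.Embedding.induce D)) fun w hw => ?_
      exact (hConn t1 h1).2.2.2.2 w w.2
        (hw.isHubIn_of_induce (Set.sdiff_subset.trans Set.subset_union_right))
    obtain ⟨Y, hYD, hYcard, hY⟩ := exists_balanced_separator_induce htw
    refine hbal ⟨X₀ ∩ B ∪ Y, Set.union_subset Set.inter_subset_right (hYD.trans (hside t1 h1)), ?_,
      fun E hE => ?_⟩
    · have h2 := Set.ncard_union_le (X₀ ∩ B) Y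
      have h3 := Set.ncard_le_ncard (Set.inter_subset_left (s := X₀) (t := B))
      omega
    · obtain ⟨hEsub, hEconn, -⟩ := hE
      obtain ⟨hEB, hEX⟩ := Set.subset_sdiff.mp hEsub
      rw [Set.disjoint_union_right] at hEX
      by_cases hmeet : (E ∩ D).Nonempty
      · have h2 := hY E hEconn (hcut t1 h1 hs1 E hEconn hEX.1 hEB hmeet) hEX.2
        have h3 := Set.ncard_le_ncard (hside t1 h1)
        exact h2.trans h3
      · have h2 := Set.ncard_union_eq
          (Set.disjoint_iff_inter_eq_empty.mpr (Set.not_nonempty_iff_eq_empty.mp hmeet))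
        have h3 := Set.ncard_le_ncard (Set.union_subset hEB (hside t1 h1))
        rw [← hD] at h3
        omega
  · push Not at hlarge
    refine hbal ⟨X₀ ∩ B, Set.inter_subset_right, ?_, fun E hE => ?_⟩
    · have h3 := Set.ncard_le_ncard (Set.inter_subset_left (s := X₀) (t := B))
      omega
    obtain ⟨hEsub, hEconn, -⟩ := hE
    obtain ⟨hEB, hEX⟩ := Set.subset_sdiff.mp hEsub
    by_cases hmeet : ∃ t1, T.Adj t0 t1 ∧ s ∈ χ t1 ∧ (E ∩ (Conn t1 \ χ t0)).Nonempty
    · obtain ⟨t1, h1, hs1, hmeet⟩ := hmeet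
      have h2 := Set.ncard_le_ncard (hcut t1 h1 hs1 E hEconn hEX hEB hmeet)
      have h3 := hlarge t1 h1 hs1
      omega
    · have hEN : E ⊆ B \ {v ∈ B | v = s ∨ G.Adj s v} := by
        refine fun v hvE => ⟨hEB hvE, fun ⟨hvB, hv⟩ => ?_⟩
        have hvX : v ∉ X₀ := fun h => Set.disjoint_left.mp hEX hvE ⟨h, hvB⟩
        have hadj : G.Adj s v := hv.resolve_left fun h => hvX (.inl h)
        have hvχ : v ∉ χ t0 := fun h => hvX (.inr ⟨hsχ, h, hadj.ne, .inl hadj⟩)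
        rw [hB] at hvB
        obtain ⟨t1, h1, hv1⟩ := Set.mem_iUnion₂.mp (hvB.1.resolve_left hvχ)
        have hsN : s ∈ setNbhd G (Conn t1 \ χ t0) := ⟨fun h => h.2 hsχ, v, ⟨hv1, hvχ⟩, hadj⟩
        rw [(hConn t1 h1).2.2.2.1] at hsN
        exact hmeet ⟨t1, h1, hsN.2, v, hvE, hv1, hvχ⟩
      obtain ⟨D, hD, hED⟩ := hEconn.exists_isCompOf hEN
      have h2 := Set.ncard_le_ncard hED
      have h3 := hcon D hD
      omega
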